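/- arXiv:0904.2600 — 5 statements merged into one kernel-verified Lean document; each statement's English description precedes it below -/
import Mathlib

section
/- Let d be a positive integer and (G,f_E) a finite e-labeled graph with labels in Z_d. Then f_E is an additive e-labeling of G if and only if (G,f_E) is compatible, i.e.: if d is odd, (G,f_E) has the even cycle property, and if d is even, (G,f_E) has both the even cycle property and the odd cycle property. -/
open SimpleGraph Finset

/-- `fV` is a valid v-labeling of the e-labeled graph `(G, fE)`:
the label of each edge is the sum (mod `d`) of the labels of its endpoints. -/
def validVLabeling {V : Type*} {d : ℕ} (G : SimpleGraph V) (fE : Sym2 V → ZMod d)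
    (fV : V → ZMod d) : Prop :=
  ∀ ⦃u v : V⦄, G.Adj u v → fE s(u, v) = fV u + fV v

/-- `fE` is an additive e-labeling of `G`: some valid v-labeling exists. -/
def IsAdditive {V : Type*} {d : ℕ} (G : SimpleGraph V) (fE : Sym2 V → ZMod d) : Prop :=
  ∃ fV : V → ZMod d, validVLabeling G fE fV

/-- The even cycle property: for every cycle (closed walk) of even length,
the alternating sum of the labels of its edge sequence vanishes, i.e. the sum of the
labels at odd positions equals the sum of the labels at even positions. -/
def EvenCycleProperty {V : Type*} {d : ℕ} (G : SimpleGraph V) (fE : Sym2 V → ZMod d) : Prop :=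
  ∀ ⦃v : V⦄ (p : G.Walk v v), Even p.length → (p.edges.map fE).alternatingSum = 0

/-- The odd cycle property (for `d` even): for every cycle (closed walk) of odd length,
`(d/2) · (sum of the labels of its edges)` vanishes in `ZMod d`. -/
def OddCycleProperty {V : Type*} (d : ℕ) (G : SimpleGraph V) (fE : Sym2 V → ZMod d) : Prop :=
  ∀ ⦃v : V⦄ (p : G.Walk v v), Odd p.length →
    ((d / 2 : ℕ) : ZMod d) * (p.edges.map fE).sum = 0

/-- `(G, fE)` is compatible: if `d` is odd it has the even cycle property, and
if `d` is even it has both the even and the odd cycle properties. -/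
def Compatible {V : Type*} (d : ℕ) (G : SimpleGraph V) (fE : Sym2 V → ZMod d) : Prop :=
  (Odd d ∧ EvenCycleProperty G fE) ∨
  (Even d ∧ EvenCycleProperty G fE ∧ OddCycleProperty d G fE)

section AlternatingLabels

variable {V : Type*} {d : ℕ} {G : SimpleGraph V} {fE : Sym2 V → ZMod d}

/-- The alternating sum of the edge labels along a walk. -/
def SimpleGraph.Walk.altLabel (fE : Sym2 V → ZMod d) {u v : V} (p : G.Walk u v) : ZMod d :=
  (p.edges.map fE).alternatingSum

lemma SimpleGraph.Walk.altLabel_append {u v w : V} (p : G.Walk u v) (q : G.Walk v w) :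
    (p.append q).altLabel fE = p.altLabel fE + (-1) ^ p.length * q.altLabel fE := by
  simp [altLabel, List.alternatingSum_append]

lemma SimpleGraph.Walk.altLabel_reverse {u v : V} (p : G.Walk u v) :
    p.reverse.altLabel fE = (-1) ^ (p.length + 1) * p.altLabel fE := by
  simp [altLabel, List.alternatingSum_reverse]

lemma SimpleGraph.Walk.altLabel_concat {u v w : V} (p : G.Walk u v) (h : G.Adj v w) :
    (p.concat h).altLabel fE = p.altLabel fE + (-1) ^ p.length * fE s(v, w) := by
  rw [Walk.concat_eq_append, altLabel_append]
  simp [altLabel]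

lemma validVLabeling.altLabel_eq {fV : V → ZMod d} (hf : validVLabeling G fE fV) {u v : V}
    (p : G.Walk u v) : p.altLabel fE = fV u - (-1) ^ p.length * fV v := by
  induction p with
  | nil => simp [Walk.altLabel]
  | cons h p ih =>
    simp only [Walk.altLabel] at ih
    simp only [Walk.altLabel, Walk.edges_cons, List.map_cons, List.alternatingSum_cons, ih, hf h,
      Walk.length_cons]
    ring

lemma validVLabeling.mul_sum_eq {fV : V → ZMod d} (hf : validVLabeling G fE fV) {c : ZMod d}
    (hc : 2 * c = 0) {u v : V} (p : G.Walk u v) :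
    c * (p.edges.map fE).sum = c * (fV u + fV v) := by
  induction p with
  | @nil u => simp only [Walk.edges_nil, List.map_nil, List.sum_nil]; linear_combination -fV u * hc
  | @cons u w v h p ih =>
    simp only [Walk.edges_cons, List.map_cons, List.sum_cons, hf h]
    linear_combination ih + fV w * hc

lemma List.mul_alternatingSum_eq_mul_sum {R : Type*} [CommRing R] {c : R} (hc : 2 * c = 0)
    (l : List R) : c * l.alternatingSum = c * l.sum := by
  induction l with
  | nil => simp
  | cons a l ih =>
    simp only [List.alternatingSum_cons, List.sum_cons]
    linear_combination ih - l.alternatingSum * hc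

lemma ZMod.exists_eq_two_mul_of_odd (hd : Odd d) (s : ZMod d) : ∃ a, s = 2 * a := by
  obtain ⟨k, rfl⟩ := hd
  refine ⟨(k + 1) * s, ?_⟩
  have h := ZMod.natCast_self (2 * k + 1)
  push_cast at h
  linear_combination -s * h

lemma ZMod.two_mul_natCast_half (hd : Even d) : 2 * ((d / 2 : ℕ) : ZMod d) = 0 := by
  rw [← Nat.cast_ofNat, ← Nat.cast_mul, Nat.two_mul_div_two_of_even hd, ZMod.natCast_self]

lemma ZMod.exists_eq_two_mul_of_half_mul_eq_zero (hpos : 0 < d) (hd : Even d) {s : ZMod d}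
    (hs : ((d / 2 : ℕ) : ZMod d) * s = 0) : ∃ a, s = 2 * a := by
  have : NeZero d := ⟨hpos.ne'⟩
  have hdvd : d / 2 * 2 ∣ d / 2 * s.val := by
    rw [Nat.div_mul_cancel hd.two_dvd, ← ZMod.natCast_eq_zero_iff]
    simpa using hs
  obtain ⟨k, hk⟩ := Nat.dvd_of_mul_dvd_mul_left (by have := hd.two_dvd; omega) hdvd
  refine ⟨k, ?_⟩
  rw [← ZMod.natCast_zmod_val s, hk]
  push_cast
  rfl

/-- In an even-cycle labeling all odd closed walks at `r` have the same alternating sum, so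
divisibility by two of each of them gives a common half. -/
lemma EvenCycleProperty.exists_common_half (he : EvenCycleProperty G fE) (r : V)
    (h : ∀ p : G.Walk r r, Odd p.length → ∃ a, p.altLabel fE = 2 * a) :
    ∃ a, ∀ p : G.Walk r r, Odd p.length → p.altLabel fE = 2 * a := by
  by_cases hex : ∃ p : G.Walk r r, Odd p.length
  · obtain ⟨p, hp⟩ := hex
    obtain ⟨a, ha⟩ := h p hp
    refine ⟨a, fun q hq => ?_⟩
    have hpq : (p.append q).altLabel fE = 0 :=
      he _ (by rw [Walk.length_append]; exact hp.add_odd hq)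
    rw [Walk.altLabel_append, hp.neg_one_pow] at hpq
    linear_combination ha - hpq
  · exact ⟨0, fun p hp => (hex ⟨p, hp⟩).elim⟩

/-- If the root `r` is labeled `a`, the label forced at the end of a walk from `r` does not
depend on the walk. -/
lemma EvenCycleProperty.forced_label_eq (he : EvenCycleProperty G fE) {r v : V} {a : ZMod d}
    (ha : ∀ p : G.Walk r r, Odd p.length → p.altLabel fE = 2 * a) (p q : G.Walk r v) :
    (-1) ^ p.length * (a - p.altLabel fE) = (-1) ^ q.length * (a - q.altLabel fE) := by
  have hlen : (p.append q.reverse).length = p.length + q.length := by simp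
  have halt := Walk.altLabel_append (fE := fE) p q.reverse
  rw [Walk.altLabel_reverse, pow_succ] at halt
  have hodd := ha (p.append q.reverse)
  have heven : Even (p.append q.reverse).length → (p.append q.reverse).altLabel fE = 0 := he _
  rw [hlen, halt] at hodd heven
  rcases Nat.even_or_odd p.length with hp | hp <;> rcases Nat.even_or_odd q.length with hq | hq
  · have := heven (hp.add hq)
    simp only [hp.neg_one_pow, hq.neg_one_pow] at this ⊢
    linear_combination -this
  · have := hodd (hp.add_odd hq)
    simp only [hp.neg_one_pow, hq.neg_one_pow] at this ⊢
    linear_combination -this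
  · have := hodd (hp.add_even hq)
    simp only [hp.neg_one_pow, hq.neg_one_pow] at this ⊢
    linear_combination this
  · have := heven (hp.add_odd hq)
    simp only [hp.neg_one_pow, hq.neg_one_pow] at this ⊢
    linear_combination this

lemma EvenCycleProperty.isAdditive (he : EvenCycleProperty G fE)
    (h : ∀ (r : V) (p : G.Walk r r), Odd p.length → ∃ a, p.altLabel fE = 2 * a) :
    IsAdditive G fE := by
  choose a ha using fun r => he.exists_common_half r (h r)
  let root : V → V := fun v => (G.connectedComponentMk v).out
  have hroot : ∀ v, G.Reachable (root v) v := fun v =>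
    ConnectedComponent.exact (Quot.out_eq (G.connectedComponentMk v))
  let walk : ∀ v, G.Walk (root v) v := fun v => (hroot v).some
  refine ⟨fun v => (-1) ^ (walk v).length * (a (root v) - (walk v).altLabel fE), fun u v huv => ?_⟩
  have hr : root u = root v := by
    simp only [root, ConnectedComponent.sound huv.reachable]
  have hv := he.forced_label_eq (ha (root v)) (walk v) (((walk u).copy hr rfl).concat huv)
  have hcopy : ((walk u).copy hr rfl).altLabel fE = (walk u).altLabel fE := by
    simp [Walk.altLabel]
  rw [Walk.altLabel_concat, Walk.length_concat, Walk.length_copy, hcopy] at hv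
  have hsq : ((-1 : ZMod d) ^ (walk u).length) * (-1) ^ (walk u).length = 1 := by
    rw [← mul_pow]; simp
  beta_reduce
  rw [hv, congrArg a hr, pow_succ]
  linear_combination -fE s(u, v) * hsq

end AlternatingLabels

/-- An e-labeled finite graph `(G, fE)` with labels in `ZMod d`
(`d` a positive integer) is additive if and only if it is compatible. -/
theorem additive_iff_compatible {V : Type*} [Fintype V] (d : ℕ) (hd : 0 < d)
    (G : SimpleGraph V) (fE : Sym2 V → ZMod d) :
    IsAdditive G fE ↔ Compatible d G fE := by
  constructor
  · rintro ⟨fV, hf⟩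
    have he : EvenCycleProperty G fE := fun v p hp => by
      have := hf.altLabel_eq p
      rwa [hp.neg_one_pow, one_mul, sub_self] at this
    rcases Nat.even_or_odd d with hev | hodd
    · refine Or.inr ⟨hev, he, fun v p _ => ?_⟩
      have hc := ZMod.two_mul_natCast_half hev
      rw [hf.mul_sum_eq hc p]
      linear_combination fV v * hc
    · exact Or.inl ⟨hodd, he⟩
  · rintro (⟨hodd, he⟩ | ⟨hev, he, ho⟩)
    · exact he.isAdditive fun _ _ _ => ZMod.exists_eq_two_mul_of_odd hodd _
    · refine he.isAdditive fun r p hp => ZMod.exists_eq_two_mul_of_half_mul_eq_zero hd hev ?_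
      exact (List.mul_alternatingSum_eq_mul_sum (ZMod.two_mul_natCast_half hev) _).trans (ho p hp)
end

section
/- Let d be a positive integer and (G,f_E) a connected finite additive e-labeled graph with labels in Z_d, and let N(G,f_E) be the number of valid v-labelings of (G,f_E). If G has no odd cycles (i.e. G is bipartite), then N(G,f_E) = d. If G has at least one odd cycle, then N(G,f_E) = 1 when d is odd and N(G,f_E) = 2 when d is even. -/
open SimpleGraph Finset

/-- Along a walk, the difference of two valid v-labelings changes sign at each step. -/
theorem validVLabeling.sub_eq_of_walk {V : Type*} {d : ℕ} {G : SimpleGraph V}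
    {fE : Sym2 V → ZMod d} {f g : V → ZMod d} (hf : validVLabeling G fE f)
    (hg : validVLabeling G fE g) {u v : V} (p : G.Walk u v) :
    f v - g v = (-1) ^ p.length * (f u - g u) := by
  induction p with
  | nil => simp
  | cons h p ih =>
    rw [ih, Walk.length_cons, pow_succ]
    have := (hf h).symm.trans (hg h)
    linear_combination (-1) ^ p.length * this

/-- On a connected graph, valid v-labelings are determined by their value at one vertex. -/
theorem validVLabeling.eq_of_apply_eq {V : Type*} {d : ℕ} {G : SimpleGraph V}
    {fE : Sym2 V → ZMod d} {f g : V → ZMod d} (hconn : G.Connected)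
    (hf : validVLabeling G fE f) (hg : validVLabeling G fE g) {v : V} (h : f v = g v) :
    f = g := by
  funext w
  obtain ⟨p⟩ := hconn.preconnected v w
  simpa [h, sub_eq_zero] using hf.sub_eq_of_walk hg p

theorem card_validVLabelings_of_colorable_two {V : Type*} {d : ℕ} {G : SimpleGraph V}
    {fE : Sym2 V → ZMod d} (hconn : G.Connected) (hadd : IsAdditive G fE)
    (hcol : G.Colorable 2) :
    Nat.card {fV : V → ZMod d // validVLabeling G fE fV} = d := by
  obtain ⟨f, hf⟩ := hadd
  obtain ⟨c⟩ := hcol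
  obtain ⟨v⟩ := hconn.nonempty
  have hbij : Function.Bijective
      fun g : {fV : V → ZMod d // validVLabeling G fE fV} ↦ g.1 v - f v := by
    refine ⟨fun g g' h ↦ Subtype.ext (g.2.eq_of_apply_eq hconn g'.2 (sub_left_inj.1 h)),
      fun a ↦ ⟨⟨fun w ↦ f w + if c w = c v then a else -a, fun u w huw ↦ ?_⟩, by simp⟩⟩
    have hne : c u ≠ c w := c.valid huw
    rw [hf huw]
    beta_reduce
    by_cases hu : c u = c v
    · rw [if_pos hu, if_neg (by omega)]
      ring
    · rw [if_neg hu, if_pos (by omega)]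
      ring
  rw [Nat.card_congr (Equiv.ofBijective _ hbij), Nat.card_zmod]

theorem card_validVLabelings_of_odd_walk {V : Type*} {d : ℕ} {G : SimpleGraph V}
    {fE : Sym2 V → ZMod d} (hconn : G.Connected) (hadd : IsAdditive G fE)
    {v : V} (p : G.Walk v v) (hp : Odd p.length) :
    Nat.card {fV : V → ZMod d // validVLabeling G fE fV} =
      Nat.card {a : ZMod d // a + a = 0} := by
  obtain ⟨f, hf⟩ := hadd
  have hmem (g : {fV : V → ZMod d // validVLabeling G fE fV}) :
      (g.1 v - f v) + (g.1 v - f v) = 0 := by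
    have := g.2.sub_eq_of_walk hf p
    rw [hp.neg_one_pow] at this
    linear_combination this
  refine Nat.card_congr (Equiv.ofBijective (fun g ↦ ⟨g.1 v - f v, hmem g⟩) ⟨fun g g' h ↦ ?_,
    fun a ↦ ⟨⟨fun w ↦ f w + a, fun u w huw ↦ ?_⟩, by simp⟩⟩)
  · exact Subtype.ext (g.2.eq_of_apply_eq hconn g'.2 (sub_left_inj.1 (Subtype.ext_iff.1 h)))
  · rw [hf huw]
    linear_combination -a.2

theorem ZMod.card_add_self_eq_zero_of_odd {d : ℕ} (hd : Odd d) :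
    Nat.card {a : ZMod d // a + a = 0} = 1 := by
  simp [ZMod.add_self_eq_zero_iff_eq_zero hd]

theorem ZMod.card_add_self_eq_zero_of_even {d : ℕ} (hpos : 0 < d) (hd : Even d) :
    Nat.card {a : ZMod d // a + a = 0} = 2 := by
  have : NeZero d := ⟨hpos.ne'⟩
  obtain ⟨k, rfl⟩ := hd
  have hval : ((k : ℕ) : ZMod (k + k)).val = k := ZMod.val_natCast_of_lt (by omega)
  have hset : {a : ZMod (k + k) | a + a = 0} = {0, (k : ZMod (k + k))} := by
    ext a
    rw [Set.mem_ofPred_eq, ← neg_eq_iff_add_eq_zero, ZMod.neg_eq_self_iff, Set.mem_insert_iff,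
      Set.mem_singleton_iff, ← (ZMod.val_injective (k + k)).eq_iff (b := (k : ZMod (k + k))), hval]
    exact or_congr_right (by omega)
  have hne : (0 : ZMod (k + k)) ≠ k := by
    intro h
    rw [← h, ZMod.val_zero] at hval
    omega
  change Nat.card ({a : ZMod (k + k) | a + a = 0} : Set _) = 2
  rw [hset, Nat.card_coe_set_eq, Set.ncard_pair hne]

/-- Number of valid v-labelings of a connected additive e-labeled graph:
`d` if `G` has no odd cycles (is bipartite); otherwise `1` for odd `d` and `2` for even `d`. -/
theorem card_validVLabelings {V : Type*} [Fintype V] (d : ℕ) (hd : 0 < d)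
    (G : SimpleGraph V) (fE : Sym2 V → ZMod d)
    (hconn : G.Connected) (hadd : IsAdditive G fE) :
    ((¬ ∃ (v : V) (p : G.Walk v v), Odd p.length) →
        Nat.card {fV : V → ZMod d // validVLabeling G fE fV} = d) ∧
    ((∃ (v : V) (p : G.Walk v v), Odd p.length) →
        (Odd d → Nat.card {fV : V → ZMod d // validVLabeling G fE fV} = 1) ∧
        (Even d → Nat.card {fV : V → ZMod d // validVLabeling G fE fV} = 2)) := by
  refine ⟨fun h ↦ card_validVLabelings_of_colorable_two hconn hadd ?_, ?_⟩
  · rw [two_colorable_iff_forall_loop_even]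
    exact fun u w ↦ Nat.not_odd_iff_even.1 fun hw ↦ h ⟨u, w, hw⟩
  · rintro ⟨v, p, hp⟩
    rw [card_validVLabelings_of_odd_walk hconn hadd p hp]
    exact ⟨ZMod.card_add_self_eq_zero_of_odd, ZMod.card_add_self_eq_zero_of_even hd⟩
end

section
/- Let d be a positive integer and let C be the cycle graph on an odd number 2k+1 of vertices, equipped with a compatible e-labeling f_E with labels in Z_d. Then (C,f_E) is additive. Moreover, if d is odd then (C,f_E) has exactly one valid v-labeling, and if d is even then (C,f_E) has exactly two valid v-labelings. -/
open SimpleGraph Finset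

section

open scoped Fin.CommRing

/-- The vertex labels obtained by propagating the label `s` along a path with edge labels `a`. -/
def propagatedLabel {R : Type*} [AddGroup R] (a : ℕ → R) (s : R) : ℕ → R
  | 0 => s
  | i + 1 => a i - propagatedLabel a s i

theorem propagatedLabel_eq {R : Type*} [CommRing R] (a : ℕ → R) (s : R) (i : ℕ) :
    propagatedLabel a s i = (-1) ^ i * (s - ∑ j ∈ range i, (-1) ^ j * a j) := by
  induction i with
  | zero => simp [propagatedLabel]
  | succ i ih =>
    have h : ((-1 : R) ^ i) * (-1) ^ i = 1 := by rw [← mul_pow]; simp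
    rw [propagatedLabel, ih, sum_range_succ, pow_succ]
    linear_combination (-a i) * h

theorem cycleGraph_adj_iff_eq_add_one {k : ℕ} (hk : 1 ≤ k) (u v : Fin (2 * k + 1)) :
    (cycleGraph (2 * k + 1)).Adj u v ↔ u = v + 1 ∨ v = u + 1 := by
  obtain ⟨m, rfl⟩ : ∃ m, k = m + 1 := ⟨k - 1, by omega⟩
  have h := @cycleGraph_adj (2 * m + 1) u v
  rw [sub_eq_iff_eq_add', sub_eq_iff_eq_add'] at h
  exact h

theorem validVLabeling_cycleGraph_iff {d k : ℕ} (hk : 1 ≤ k)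
    (fE : Sym2 (Fin (2 * k + 1)) → ZMod d) (fV : Fin (2 * k + 1) → ZMod d) :
    validVLabeling (cycleGraph (2 * k + 1)) fE fV ↔
      ∀ i, fE s(i, i + 1) = fV i + fV (i + 1) := by
  constructor
  · intro h i
    exact h ((cycleGraph_adj_iff_eq_add_one hk _ _).2 (Or.inr rfl))
  · intro h u v huv
    rcases (cycleGraph_adj_iff_eq_add_one hk _ _).1 huv with rfl | rfl
    · rw [Sym2.eq_swap, h, add_comm]
    · exact h u

/-- The label of the `i`-th edge of the cycle graph, indexed by natural numbers. -/
def cycleEdgeLabel {d k : ℕ} (fE : Sym2 (Fin (2 * k + 1)) → ZMod d) (i : ℕ) : ZMod d :=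
  fE s((i : Fin (2 * k + 1)), (i : Fin (2 * k + 1)) + 1)

/-- The alternating sum of the edge labels around the odd cycle. -/
def cycleAlternatingSum {d k : ℕ} (fE : Sym2 (Fin (2 * k + 1)) → ZMod d) : ZMod d :=
  ∑ j ∈ range (2 * k + 1), (-1) ^ j * cycleEdgeLabel fE j

theorem propagatedLabel_closes_iff {d k : ℕ} (fE : Sym2 (Fin (2 * k + 1)) → ZMod d)
    (s : ZMod d) :
    cycleEdgeLabel fE (2 * k) = propagatedLabel (cycleEdgeLabel fE) s (2 * k) + s ↔
      2 * s = cycleAlternatingSum fE := by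
  rw [propagatedLabel_eq, cycleAlternatingSum, sum_range_succ, pow_mul]
  simp only [even_two, Even.neg_pow, one_pow, one_mul]
  constructor <;> intro h <;> linear_combination -h

theorem validVLabeling_eq_propagatedLabel {d k : ℕ} (hk : 1 ≤ k)
    {fE : Sym2 (Fin (2 * k + 1)) → ZMod d} {fV : Fin (2 * k + 1) → ZMod d}
    (h : validVLabeling (cycleGraph (2 * k + 1)) fE fV) (i : ℕ) :
    fV (i : Fin (2 * k + 1)) = propagatedLabel (cycleEdgeLabel fE) (fV 0) i := by
  rw [validVLabeling_cycleGraph_iff hk] at h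
  induction i with
  | zero => simp [propagatedLabel]
  | succ i ih =>
    rw [propagatedLabel, ← ih, cycleEdgeLabel, h, Nat.cast_succ]
    ring

theorem natCast_two_mul_add_one (k : ℕ) : ((2 * k : ℕ) : Fin (2 * k + 1)) + 1 = 0 := by
  rw [← Nat.cast_succ]
  exact Fin.natCast_self _

theorem validVLabeling_propagatedLabel {d k : ℕ} (hk : 1 ≤ k)
    {fE : Sym2 (Fin (2 * k + 1)) → ZMod d} {s : ZMod d}
    (hs : 2 * s = cycleAlternatingSum fE) :
    validVLabeling (cycleGraph (2 * k + 1)) fE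
      (fun i => propagatedLabel (cycleEdgeLabel fE) s i.val) := by
  rw [validVLabeling_cycleGraph_iff hk]
  intro i
  have hi : fE s(i, i + 1) = cycleEdgeLabel fE i.val := by
    simp [cycleEdgeLabel]
  rw [hi]
  by_cases hlast : i = Fin.last (2 * k)
  · subst hlast
    simpa [propagatedLabel] using (propagatedLabel_closes_iff fE s).2 hs
  · rw [Fin.val_add_one, if_neg hlast, propagatedLabel]
    ring

/-- Valid labelings of an odd cycle correspond to the halves of the alternating sum. -/
def validVLabelingEquiv {d k : ℕ} (hk : 1 ≤ k) (fE : Sym2 (Fin (2 * k + 1)) → ZMod d) :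
    {fV : Fin (2 * k + 1) → ZMod d // validVLabeling (cycleGraph (2 * k + 1)) fE fV} ≃
      {s : ZMod d // 2 * s = cycleAlternatingSum fE} where
  toFun fV := ⟨fV.1 0, by
    rw [← propagatedLabel_closes_iff, ← validVLabeling_eq_propagatedLabel hk fV.2,
      cycleEdgeLabel, (validVLabeling_cycleGraph_iff hk _ _).1 fV.2, natCast_two_mul_add_one]⟩
  invFun s := ⟨_, validVLabeling_propagatedLabel hk s.2⟩
  left_inv fV := by
    ext i
    simp [← validVLabeling_eq_propagatedLabel hk fV.2]
  right_inv s := by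
    ext
    simp [propagatedLabel]

theorem exists_walk_cycleGraph_sum {d k : ℕ} (hk : 1 ≤ k)
    (fE : Sym2 (Fin (2 * k + 1)) → ZMod d) (m : ℕ) :
    ∃ p : (cycleGraph (2 * k + 1)).Walk 0 (m : Fin (2 * k + 1)),
      p.length = m ∧ (p.edges.map fE).sum = ∑ j ∈ range m, cycleEdgeLabel fE j := by
  induction m with
  | zero => exact ⟨Walk.nil.copy rfl (by simp), by simp⟩
  | succ m ih =>
    obtain ⟨p, hp, hsum⟩ := ih
    rw [Nat.cast_succ]
    refine ⟨p.concat ((cycleGraph_adj_iff_eq_add_one hk _ _).2 (Or.inr rfl)), by simp [hp], ?_⟩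
    simp [Walk.edges_concat, hsum, sum_range_succ, cycleEdgeLabel]

theorem half_mul_cycleAlternatingSum {d k : ℕ} (hk : 1 ≤ k) (hd : Even d)
    {fE : Sym2 (Fin (2 * k + 1)) → ZMod d}
    (h : OddCycleProperty d (cycleGraph (2 * k + 1)) fE) :
    ((d / 2 : ℕ) : ZMod d) * cycleAlternatingSum fE = 0 := by
  obtain ⟨p, hp, hsum⟩ := exists_walk_cycleGraph_sum hk fE (2 * k + 1)
  have hp0 := h (p.copy rfl (Fin.natCast_self _)) (by simp [hp])
  rw [Walk.edges_copy, hsum] at hp0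
  have hhalf : ((d / 2 : ℕ) : ZMod d) * 2 = 0 := by
    exact_mod_cast (congrArg (Nat.cast : ℕ → ZMod d) (Nat.div_mul_cancel hd.two_dvd)).trans
      (ZMod.natCast_self d)
  rw [← hp0, cycleAlternatingSum, mul_sum, mul_sum]
  refine sum_congr rfl fun j _ => ?_
  rcases neg_one_pow_eq_or (ZMod d) j with hj | hj <;> rw [hj]
  · ring
  · linear_combination (-cycleEdgeLabel fE j) * hhalf

end

theorem card_halves_of_odd {d : ℕ} (hd : Odd d) (t : ZMod d) :
    Nat.card {s : ZMod d // 2 * s = t} = 1 := by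
  have hu : IsUnit (2 : ZMod d) := by
    exact_mod_cast (ZMod.isUnit_iff_coprime 2 d).2 hd.coprime_two_left
  obtain ⟨s, rfl⟩ : ∃ s, 2 * s = t := ⟨hu.unit⁻¹ * t, by simp [← mul_assoc]⟩
  simp [hu.mul_right_inj]

theorem ZMod.two_mul_eq_zero_iff {d : ℕ} (hd : 0 < d) (hd2 : Even d) (u : ZMod d) :
    2 * u = 0 ↔ u = 0 ∨ u = (d / 2 : ℕ) := by
  have : NeZero d := ⟨hd.ne'⟩
  obtain ⟨c, rfl⟩ := hd2.two_dvd
  have hlt := u.val_lt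
  rw [Nat.mul_div_cancel_left c two_pos]
  constructor
  · intro h
    have hdvd : 2 * c ∣ 2 * u.val := by
      rw [← ZMod.natCast_eq_zero_iff]
      simpa using h
    obtain ⟨q, hq⟩ := (Nat.mul_dvd_mul_iff_left two_pos).1 hdvd
    have hq2 : q < 2 := by nlinarith
    interval_cases q
    · exact Or.inl ((ZMod.val_eq_zero u).1 (by simpa using hq))
    · right
      rw [← ZMod.natCast_zmod_val u, hq, mul_one]
  · rintro (rfl | rfl)
    · simp
    · exact_mod_cast ZMod.natCast_self (2 * c)

theorem card_halves_of_even {d : ℕ} (hd : 0 < d) (hd2 : Even d) {t : ZMod d}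
    (ht : ((d / 2 : ℕ) : ZMod d) * t = 0) :
    Nat.card {s : ZMod d // 2 * s = t} = 2 := by
  have : NeZero d := ⟨hd.ne'⟩
  have hc : 0 < d / 2 := by have := hd2.two_dvd; omega
  obtain ⟨r, rfl⟩ : ∃ r, 2 * r = t := by
    have hdvd : d / 2 * 2 ∣ d / 2 * t.val := by
      rw [Nat.div_mul_cancel hd2.two_dvd, ← ZMod.natCast_eq_zero_iff]
      simpa using ht
    obtain ⟨q, hq⟩ := (Nat.mul_dvd_mul_iff_left hc).1 hdvd
    refine ⟨q, ?_⟩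
    rw [← ZMod.natCast_zmod_val t, hq]
    push_cast
    rfl
  have hne : ((d / 2 : ℕ) : ZMod d) ≠ 0 := by
    rw [Ne, ZMod.natCast_eq_zero_iff]
    exact Nat.not_dvd_of_pos_of_lt hc (by omega)
  have hset : {s : ZMod d | 2 * s = 2 * r} = {r, r + (d / 2 : ℕ)} := by
    ext s
    rw [Set.mem_ofPred_eq, ← sub_eq_zero, ← mul_sub, ZMod.two_mul_eq_zero_iff hd hd2,
      sub_eq_zero, sub_eq_iff_eq_add']
    rfl
  change Nat.card {s : ZMod d | 2 * s = 2 * r} = 2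
  rw [hset, Nat.card_coe_set_eq, Set.ncard_pair (by simpa using hne)]

/-- A compatible e-labeled simple cycle of odd length `2k+1` is additive;
it has exactly one valid v-labeling when `d` is odd and exactly two when `d` is even. -/
theorem oddCycleGraph_compatible_additive (d k : ℕ) (hd : 0 < d) (hk : 1 ≤ k)
    (fE : Sym2 (Fin (2 * k + 1)) → ZMod d)
    (hcomp : Compatible d (cycleGraph (2 * k + 1)) fE) :
    IsAdditive (cycleGraph (2 * k + 1)) fE ∧
    (Odd d →
      Nat.card {fV : Fin (2 * k + 1) → ZMod d //
        validVLabeling (cycleGraph (2 * k + 1)) fE fV} = 1) ∧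
    (Even d →
      Nat.card {fV : Fin (2 * k + 1) → ZMod d //
        validVLabeling (cycleGraph (2 * k + 1)) fE fV} = 2) := by
  have hodd : Odd d → Nat.card {fV : Fin (2 * k + 1) → ZMod d //
      validVLabeling (cycleGraph (2 * k + 1)) fE fV} = 1 := fun hd2 => by
    rw [Nat.card_congr (validVLabelingEquiv hk fE), card_halves_of_odd hd2]
  have heven : Even d → Nat.card {fV : Fin (2 * k + 1) → ZMod d //
      validVLabeling (cycleGraph (2 * k + 1)) fE fV} = 2 := fun hd2 => by
    rcases hcomp with ⟨hd1, -⟩ | ⟨-, -, h⟩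
    · exact absurd hd2 (Nat.not_even_iff_odd.2 hd1)
    · rw [Nat.card_congr (validVLabelingEquiv hk fE),
        card_halves_of_even hd hd2 (half_mul_cycleAlternatingSum hk hd2 h)]
  refine ⟨?_, hodd, heven⟩
  have hpos : 0 < Nat.card {fV : Fin (2 * k + 1) → ZMod d //
      validVLabeling (cycleGraph (2 * k + 1)) fE fV} := by
    rcases Nat.even_or_odd d with h | h
    · rw [heven h]; exact two_pos
    · rw [hodd h]; exact one_pos
  obtain ⟨fV, hfV⟩ := (Nat.card_pos_iff.1 hpos).1
  exact ⟨fV, hfV⟩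
end

section
/- Let d be an even positive integer and let C be the cycle graph on an odd number of vertices, equipped with an additive e-labeling f_E with labels in Z_d. If f_V and f_{V'} are the two distinct valid v-labelings of (C,f_E), then f_V(v) = f_{V'}(v) + d/2 in Z_d for every vertex v of C. -/
open SimpleGraph Finset

/-- Along any edge, the difference of two valid v-labelings changes sign. -/
theorem validVLabeling.sub_eq_neg_sub {V : Type*} {d : ℕ} {G : SimpleGraph V}
    {fE : Sym2 V → ZMod d} {fV fV' : V → ZMod d} (hfV : validVLabeling G fE fV)
    (hfV' : validVLabeling G fE fV') {u v : V} (huv : G.Adj u v) :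
    fV v - fV' v = -(fV u - fV' u) := by
  have h := (hfV huv).symm.trans (hfV' huv)
  linear_combination h

/-- A nonzero element of `ZMod d` equal to its own negative is `d / 2`. -/
theorem ZMod.eq_half_of_neg_eq_self {d : ℕ} [NeZero d] {a : ZMod d} (ha : a ≠ 0)
    (hneg : -a = a) : a = ((d / 2 : ℕ) : ZMod d) := by
  have hval : 2 * a.val = d := (a.neg_eq_self_iff.1 hneg).resolve_left ha
  rw [show d / 2 = a.val by omega, ZMod.natCast_zmod_val]

open scoped Fin.CommRing in
/-- A function on an odd cycle that changes sign along every step is constant, and its value is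
its own negative. -/
theorem Fin.eq_apply_zero_and_neg_eq_self_of_odd {A : Type*} [AddGroup A] {k : ℕ}
    {g : Fin (2 * k + 1) → A} (hg : ∀ i, g (i + 1) = -g i) :
    (∀ i, g i = g 0) ∧ -g 0 = g 0 := by
  have even_step : ∀ n : ℕ, g ((2 * n : ℕ) : Fin (2 * k + 1)) = g 0 := by
    intro n
    induction n with
    | zero => simp
    | succ n ih =>
      rw [show 2 * (n + 1) = 2 * n + 1 + 1 by ring, Nat.cast_succ, Nat.cast_succ, hg, hg, neg_neg,
        ih]
  have hneg : -g 0 = g 0 := by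
    rw [← even_step k, ← hg, ← Nat.cast_succ, Fin.natCast_self, even_step]
  refine ⟨fun i => ?_, hneg⟩
  rw [← Fin.cast_val_eq_self i]
  obtain ⟨m, hm | hm⟩ := Nat.even_or_odd' i.val
  · rw [hm, even_step]
  · rw [hm, Nat.cast_add_one, hg, even_step, hneg]

/-- For `d` even, the two distinct valid v-labelings of an additive
e-labeled simple cycle of odd length differ by `d/2` at every vertex. -/
theorem oddCycleGraph_labelings_differ_by_half (d k : ℕ) (hd : 0 < d) (hdeven : Even d)
    (hk : 1 ≤ k) (fE : Sym2 (Fin (2 * k + 1)) → ZMod d)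
    (fV fV' : Fin (2 * k + 1) → ZMod d)
    (hfV : validVLabeling (cycleGraph (2 * k + 1)) fE fV)
    (hfV' : validVLabeling (cycleGraph (2 * k + 1)) fE fV')
    (hne : fV ≠ fV') :
    ∀ v : Fin (2 * k + 1), fV v = fV' v + ((d / 2 : ℕ) : ZMod d) := by
  have : NeZero d := ⟨hd.ne'⟩
  obtain ⟨hconst, hneg⟩ := Fin.eq_apply_zero_and_neg_eq_self_of_odd (g := fun i => fV i - fV' i)
    fun i => hfV.sub_eq_neg_sub hfV' <| by
      obtain ⟨m, rfl⟩ := Nat.exists_eq_add_of_le' hk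
      exact cycleGraph_adj.2 (Or.inr (add_sub_cancel_left i 1))
  have hzero : fV 0 - fV' 0 ≠ 0 := fun h =>
    hne (funext fun i => sub_eq_zero.1 ((hconst i).trans h))
  intro v
  rw [← ZMod.eq_half_of_neg_eq_self hzero hneg, ← hconst v, add_sub_cancel]
end

section
/- Let d be a positive integer and (G,f_E) a connected finite compatible e-labeled graph with labels in Z_d. Let C and C' be two cycles of odd length in G, with edge sequences e_1,...,e_r and e'_1,...,e'_s respectively, sharing a common vertex v_1 such that both e_1 and e'_1 are incident to v_1. Then ∑_{l=1}^{r} (-1)^{r-l} f_E(e_l) = ∑_{l=1}^{s} (-1)^{s-l} f_E(e'_l) in Z_d. -/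
open SimpleGraph Finset

/-- In a connected compatible e-labeled graph, two odd cycles starting
at a common vertex `v₁` have the same alternating sum of edge labels
(`∑_{l=1}^{r} (-1)^{r-l} fE(e_l)`, which for odd length equals the 0-indexed
alternating sum). -/
theorem alternatingSum_eq_of_odd_cycles {V : Type*} [Fintype V] (d : ℕ) (hd : 0 < d)
    (G : SimpleGraph V) (fE : Sym2 V → ZMod d) (hconn : G.Connected)
    (hcomp : Compatible d G fE) (v₁ : V)
    (p q : G.Walk v₁ v₁) (hp : Odd p.length) (hq : Odd q.length) :
    (p.edges.map fE).alternatingSum = (q.edges.map fE).alternatingSum := by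
  have heven : EvenCycleProperty G fE := hcomp.elim And.right fun h => h.2.1
  have h := heven (p.append q) (by rw [Walk.length_append]; exact hp.add_odd hq)
  rw [Walk.edges_append, List.map_append, List.alternatingSum_append, List.length_map,
    Walk.length_edges, hp.neg_one_pow, neg_one_smul] at h
  exact add_neg_eq_zero.mp h
end
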